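/- Let ℓ ≥ 2 and let T_ℓ : C_ℓ → C_ℓ be the action of the SMART machine on cyclic tapes of length ℓ. Then every configuration w ∈ C_ℓ containing a head can be written as w = T_ℓ^n(C_q) for exactly one pair (q, n) with q ∈ {▶,◀,▷,◁} and 0 ≤ n < 2ℓ·3^ℓ; in other words, the permutation T_ℓ restricted to head-containing configurations consists of exactly four disjoint cycles, each of length 2ℓ·3^ℓ, namely the orbits of C_▶, C_◀, C_▷, C_◁. Moreover, T_ℓ^{2·3^ℓ}(w) = σ^{−1}(w) for every w in the orbit of C_▶ or of C_▷, and T_ℓ^{2·3^ℓ}(w) = σ(w) for every w in the orbit of C_◀ or of C_◁. -/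

import Mathlib

/-! ### Turing machine symbols and local step functions -/

/-- Tape/head symbols: a plain tape letter, or a head `(q, a)` on top of letter `a`. -/
abbrev TSym (Q Γ : Type) : Type := Γ ⊕ (Q × Γ)

/-- The tape letter carried by a cell (under the head if the cell carries the head). -/
def tapeLetter {Q Γ : Type} : TSym Q Γ → Γ
  | Sum.inl a => a
  | Sum.inr (_, a) => a

/-- A complete deterministic machine is given by a head-step function: at `(q, a)` it either
rewrites the head in place (`.inl (q', b)`, a matching transition), or moves in direction
`δ ∈ {+1, -1}` into state `q'` (`.inr (δ, q')`, a move transition). -/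
abbrev HeadStep (Q Γ : Type) : Type := Q → Γ → ((Q × Γ) ⊕ (ℤ × Q))

/-- If the symbol `s` carries a head about to move in direction `d`, the state in which the
head arrives; `none` otherwise. -/
def arrivesAs {Q Γ : Type} (δ : HeadStep Q Γ) (s : TSym Q Γ) (d : ℤ) : Option Q :=
  match s with
  | Sum.inl _ => none
  | Sum.inr (q, a) =>
    match δ q a with
    | Sum.inl _ => none
    | Sum.inr (d', q') => if d' = d then some q' else none

/-- The local rule of the moving-head dynamics: the new symbol of a cell, given the symbols
`l, c, r` of its left neighbour, itself, and its right neighbour. -/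
def localStep {Q Γ : Type} (δ : HeadStep Q Γ) (l c r : TSym Q Γ) : TSym Q Γ :=
  match c with
  | Sum.inr (q, a) =>
    (match δ q a with
     | Sum.inl qb => Sum.inr qb
     | Sum.inr _ => Sum.inl a)
  | Sum.inl a =>
    (match arrivesAs δ l 1 with
     | some q' => Sum.inr (q', a)
     | none =>
       match arrivesAs δ r (-1) with
       | some q' => Sum.inr (q', a)
       | none => Sum.inl a)

/-- The moving-head action of a complete deterministic machine on bi-infinite tapes. -/
def stepZ {Q Γ : Type} (δ : HeadStep Q Γ) (x : ℤ → TSym Q Γ) : ℤ → TSym Q Γ :=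
  fun i => localStep δ (x (i - 1)) (x i) (x (i + 1))

/-- The action of a complete deterministic machine on cyclic tapes of length `ℓ`. -/
def stepC {Q Γ : Type} (δ : HeadStep Q Γ) (ℓ : ℕ) (w : ZMod ℓ → TSym Q Γ) :
    ZMod ℓ → TSym Q Γ :=
  fun i => localStep δ (w (i - 1)) (w i) (w (i + 1))

/-- A configuration has at most one head. -/
def AtMostOneHeadZ {Q Γ : Type} (x : ℤ → TSym Q Γ) : Prop :=
  ∀ i j : ℤ, (x i).isRight = true → (x j).isRight = true → i = j

/-- A cyclic configuration has at most one head. -/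
def AtMostOneHeadC {Q Γ : Type} {ℓ : ℕ} (w : ZMod ℓ → TSym Q Γ) : Prop :=
  ∀ i j : ZMod ℓ, (w i).isRight = true → (w j).isRight = true → i = j

/-! ### The SMART machine -/

/-- The four arrows `▶, ◀, ▷, ◁` (filled right/left, hollow right/left). -/
inductive Arrow : Type
  | rf  -- ▶ (filled right)
  | lf  -- ◀ (filled left)
  | rh  -- ▷ (hollow right)
  | lh  -- ◁ (hollow left)
deriving DecidableEq

/-- The SMART state set `Q̊`: an arrow with a subscript in `{1,2}`; the subscript `b`
is represented by the `Fin 2` value `b - 1`. -/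
abbrev SQ : Type := Arrow × Fin 2

/-- The SMART tape alphabet `{0,1,2}`. -/
abbrev Letter : Type := Fin 3

/-- The head-step function of the SMART machine.  States `q₂` (second component `1`) are
move states; states `q₁` (second component `0`) are matching states. -/
def smartStep : HeadStep SQ Letter := fun q a =>
  if q.2 = 1 then
    match q.1 with
    | .rf => Sum.inr (1, (.rf, 0))   -- (▶₂, +1, ▶₁)
    | .lf => Sum.inr (-1, (.lf, 0))  -- (◀₂, −1, ◀₁)
    | .rh => Sum.inr (1, (.rh, 0))   -- (▷₂, +1, ▷₁)
    | .lh => Sum.inr (-1, (.lh, 0))  -- (◁₂, −1, ◁₁)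
  else
    match q.1 with
    | .rf => Sum.inl (if a = 0 then ((.lf, 1), 1) else if a = 1 then ((.lh, 1), 1) else ((.lh, 1), 2))
    | .lf => Sum.inl (if a = 0 then ((.rf, 1), 1) else if a = 1 then ((.rh, 1), 1) else ((.rh, 1), 2))
    | .rh => Sum.inl (if a = 0 then ((.rf, 1), 2) else if a = 1 then ((.rf, 1), 0) else ((.lh, 1), 0))
    | .lh => Sum.inl (if a = 0 then ((.lf, 1), 2) else if a = 1 then ((.lf, 1), 0) else ((.rh, 1), 0))

/-- The cyclic shift `σ(w)_i = w_{i+1}` on cyclic tapes of length `ℓ`. -/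
def cshift {Q Γ : Type} {ℓ : ℕ} (w : ZMod ℓ → TSym Q Γ) : ZMod ℓ → TSym Q Γ :=
  fun i => w (i + 1)

/-- The initial cyclic configuration `C_q` of length `ℓ`: all-zero tape with the head
`(q₁, 0)` at position `0`. -/
def initConf (ℓ : ℕ) (q : Arrow) : ZMod ℓ → TSym SQ Letter :=
  fun i => if i = 0 then Sum.inr ((q, 0), 0) else Sum.inl 0

namespace Smart

open Function

/-! ### Configurations as tape, head position and state -/

instance : Fintype Arrow := ⟨{.rf, .lf, .rh, .lh}, fun q => by cases q <;> decide⟩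

/-- A configuration with a head: the tape, the head position and the state. -/
abbrev Cfg (ℓ : ℕ) : Type := (ZMod ℓ → Letter) × ZMod ℓ × SQ

/-- The machine acting on configurations with a head. -/
def tick {ℓ : ℕ} (c : Cfg ℓ) : Cfg ℓ :=
  match smartStep c.2.2 (c.1 c.2.1) with
  | Sum.inl (q, b) => (update c.1 c.2.1 b, c.2.1, q)
  | Sum.inr (d, q) => (c.1, c.2.1 + d, q)

/-- The cyclic word representing a configuration with a head. -/
def toWord {ℓ : ℕ} (c : Cfg ℓ) : ZMod ℓ → TSym SQ Letter :=
  fun i => if i = c.2.1 then Sum.inr (c.2.2, c.1 i) else Sum.inl (c.1 i)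

/-- The arrow with the given filling and direction (`true` is rightwards). -/
def arrow : Bool → Bool → Arrow
  | true, true => .rf
  | true, false => .lf
  | false, true => .rh
  | false, false => .lh

/-- The displacement of an arrow with the given direction. -/
def dir (ℓ : ℕ) (d : Bool) : ZMod ℓ := if d then 1 else -1

theorem dir_not (ℓ : ℕ) (d : Bool) : dir ℓ (!d) = -dir ℓ d := by
  cases d <;> simp [dir]

theorem exists_arrow (q : Arrow) : ∃ s d, q = arrow s d := by
  cases q
  exacts [⟨true, true, rfl⟩, ⟨true, false, rfl⟩, ⟨false, true, rfl⟩, ⟨false, false, rfl⟩]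

section

variable {ℓ : ℕ}

theorem toWord_injective : Injective (toWord (ℓ := ℓ)) := by
  rintro ⟨t, p, q⟩ ⟨t', p', q'⟩ h
  have hp : p = p' := by
    by_contra hne
    have := congrFun h p
    simp [toWord, hne] at this
  subst hp
  have hq : q = q' := by
    have := congrFun h p
    simp only [toWord, if_true, Sum.inr.injEq, Prod.mk.injEq] at this
    exact this.1
  subst hq
  have ht : t = t' := by
    funext i
    have := congrFun h i
    by_cases hi : i = p
    · simpa [toWord, hi] using this
    · simpa [toWord, hi] using this
  rw [ht]

theorem exists_toWord_eq {w : ZMod ℓ → TSym SQ Letter} (hw : AtMostOneHeadC w)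
    (hh : ∃ i, (w i).isRight = true) : ∃ c, toWord c = w := by
  obtain ⟨p, hp⟩ := hh
  obtain ⟨⟨q, a⟩, hqa⟩ := Sum.isRight_iff.mp hp
  refine ⟨(fun i => tapeLetter (w i), p, q), ?_⟩
  funext i
  by_cases hi : i = p
  · subst hi
    simp [toWord, hqa, tapeLetter]
  · rcases hwi : w i with b | b
    · simp [toWord, hi, hwi, tapeLetter]
    · exact absurd (hw i p (by simp [hwi]) hp) hi

theorem toWord_tick (hℓ : 2 ≤ ℓ) (c : Cfg ℓ) :
    toWord (tick c) = stepC smartStep ℓ (toWord c) := by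
  have : Fact (1 < ℓ) := ⟨hℓ⟩
  obtain ⟨t, p, q, b⟩ := c
  funext i
  have arrives : ∀ (j : ZMod ℓ) (d : ℤ), arrivesAs smartStep (toWord (t, p, q, b) j) d =
      if j = p then arrivesAs smartStep (Sum.inr ((q, b), t p)) d else none := by
    intro j d
    by_cases hj : j = p
    · simp [toWord, hj]
    · simp [toWord, hj, arrivesAs]
  have e1 : i - 1 = p ↔ i = p + 1 := sub_eq_iff_eq_add
  have e2 : i + 1 = p ↔ i = p + -1 := by rw [← sub_eq_add_neg, eq_sub_iff_add_eq]
  by_cases hi : i = p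
  · subst hi
    fin_cases b <;> cases q <;>
      simp [tick, toWord, stepC, localStep, smartStep]
  · have hc : toWord (t, p, q, b) i = Sum.inl (t i) := by simp [toWord, hi]
    simp only [stepC, localStep, hc, arrives, e1, e2]
    fin_cases b <;> cases q <;> simp [tick, smartStep, arrivesAs, toWord, hi] <;>
      split_ifs <;> rfl

theorem toWord_iterate_tick (hℓ : 2 ≤ ℓ) (n : ℕ) (c : Cfg ℓ) :
    toWord (tick^[n] c) = (stepC smartStep ℓ)^[n] (toWord c) :=
  Semiconj.iterate_right (toWord_tick hℓ) n c

theorem tick_matching (t : ZMod ℓ → Letter) (p : ZMod ℓ) (q : Arrow) : ∃ q' b,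
    smartStep (q, 0) (t p) = Sum.inl ((q', 1), b) ∧
      tick (t, p, q, 0) = (update t p b, p, q', 1) := by
  have key : ∀ (q : Arrow) (a : Letter), ∃ q' b, smartStep (q, 0) a = Sum.inl ((q', 1), b) := by
    decide
  obtain ⟨q', b, h⟩ := key q (t p)
  exact ⟨q', b, h, by simp [tick, h]⟩

theorem tick_move (t : ZMod ℓ → Letter) (p : ZMod ℓ) (s d : Bool) :
    tick (t, p, arrow s d, 1) = (t, p + dir ℓ d, arrow s d, 0) := by
  cases s <;> cases d <;> simp [tick, smartStep, arrow, dir]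

theorem tick_injective : Injective (tick (ℓ := ℓ)) := by
  have key : ∀ (x y : Arrow) (a b : Letter),
      smartStep (x, 0) a = smartStep (y, 0) b → x = y ∧ a = b := by
    decide
  rintro ⟨t, p, x, i⟩ ⟨t', p', y, j⟩ h
  obtain ⟨s, d, hx⟩ := exists_arrow x
  obtain ⟨s', d', hy⟩ := exists_arrow y
  obtain ⟨x', a, hxa, htx⟩ := tick_matching t p x
  obtain ⟨y', b, hyb, hty⟩ := tick_matching t' p' y
  have hmx := tick_move t p s d
  have hmy := tick_move t' p' s' d'
  rw [← hx] at hmx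
  rw [← hy] at hmy
  fin_cases i <;> fin_cases j <;> simp only [Fin.zero_eta, Fin.mk_one] at h ⊢
  · rw [htx, hty] at h
    simp only [Prod.mk.injEq, and_true] at h
    obtain ⟨hu, rfl, rfl⟩ := h
    have hab : a = b := by simpa using congrFun hu p
    subst hab
    obtain ⟨rfl, hp⟩ := key _ _ _ _ (hxa.trans hyb.symm)
    have ht : t = t' := by
      funext k
      by_cases hk : k = p
      · rw [hk, hp]
      · simpa [hk] using congrFun hu k
    rw [ht]
  · rw [htx, hmy] at h
    simp at h
  · rw [hmx, hty] at h
    simp at h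
  · rw [hmx, hmy] at h
    simp only [Prod.mk.injEq, and_true] at h
    obtain ⟨rfl, hp, rfl⟩ := h
    have hd : ∀ s d s' d', arrow s d = arrow s' d' → d = d' := by decide
    rw [hd s d s' d' (hx.symm.trans hy)] at hp
    rw [add_right_cancel hp]

/-! ### Runs between configurations whose state is a matching state -/

/-- The configuration with tape `t` and state `arrow s d` of index `1` at position `p`. -/
def cfg (t : ZMod ℓ → Letter) (p : ZMod ℓ) (s d : Bool) : Cfg ℓ := (t, p, arrow s d, 0)

/-- `c'` is reached from `c` after `n` pairs of a matching and a move transition. -/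
def Run (n : ℕ) (c c' : Cfg ℓ) : Prop := tick^[2 * n] c = c'

theorem Run.zero (c : Cfg ℓ) : Run 0 c c := rfl

theorem Run.trans {m n : ℕ} {a b c : Cfg ℓ} (h : Run m a b) (h' : Run n b c) :
    Run (m + n) a c := by
  unfold Run at *
  rw [add_comm, mul_add, iterate_add_apply, h, h']

theorem run_filled_zero {t : ZMod ℓ → Letter} {p : ZMod ℓ} {d : Bool} (h : t p = 0) :
    Run 1 (cfg t p true d) (cfg (update t p 1) (p - dir ℓ d) true (!d)) := by
  cases d <;> simp [Run, cfg, tick, smartStep, arrow, h, dir, sub_eq_add_neg]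

theorem run_filled_ne_zero {t : ZMod ℓ → Letter} {p : ZMod ℓ} {d : Bool} (h : t p ≠ 0) :
    Run 1 (cfg t p true d) (cfg t (p - dir ℓ d) false (!d)) := by
  have h' : t p = 1 ∨ t p = 2 := by
    revert h; generalize t p = a; revert a; decide
  rcases h' with h' | h' <;> have := update_eq_self p t <;> rw [h'] at this <;>
  cases d <;> simp [Run, cfg, tick, smartStep, arrow, h', dir, sub_eq_add_neg, this]

theorem run_hollow_zero {t : ZMod ℓ → Letter} {p : ZMod ℓ} {d : Bool} (h : t p = 0) :
    Run 1 (cfg t p false d) (cfg (update t p 2) (p + dir ℓ d) true d) := by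
  cases d <;> simp [Run, cfg, tick, smartStep, arrow, h, dir]

theorem run_hollow_one {t : ZMod ℓ → Letter} {p : ZMod ℓ} {d : Bool} (h : t p = 1) :
    Run 1 (cfg t p false d) (cfg (update t p 0) (p + dir ℓ d) true d) := by
  cases d <;> simp [Run, cfg, tick, smartStep, arrow, h, dir]

theorem run_hollow_two {t : ZMod ℓ → Letter} {p : ZMod ℓ} {d : Bool} (h : t p = 2) :
    Run 1 (cfg t p false d) (cfg (update t p 0) (p - dir ℓ d) false (!d)) := by
  cases d <;> simp [Run, cfg, tick, smartStep, arrow, h, dir, sub_eq_add_neg]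

/-! ### Sweeps over blocks of zeros -/

/-- Half the number of transitions needed to sweep over a block of `n` zeros. -/
def sweepTime : ℕ → ℕ
  | 0 => 0
  | n + 1 => 1 + sweepTime n + 1 + sweepTime n + 1 + sweepTime n

theorem sweepTime_eq (n : ℕ) : 1 + sweepTime n + 1 + sweepTime n + 1 = 3 ^ (n + 1) := by
  induction n with
  | zero => rfl
  | succ n ih => rw [pow_succ, ← ih, sweepTime]; ring

variable (ℓ) in
/-- A filled arrow crosses a block of `n` zeros preceded by a nonzero letter. -/
def FilledSweep (n : ℕ) : Prop :=
  ∀ (t : ZMod ℓ → Letter) (p : ZMod ℓ) (d : Bool), t (p - dir ℓ d) ≠ 0 →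
    (∀ k < n, t (p + k * dir ℓ d) = 0) →
    Run (sweepTime n) (cfg t p true d) (cfg t (p + n * dir ℓ d) true d)

variable (ℓ) in
/-- A hollow arrow crosses a block of `n` zeros followed by a nonzero letter. -/
def HollowSweep (n : ℕ) : Prop :=
  ∀ (t : ZMod ℓ → Letter) (p : ZMod ℓ) (d : Bool), t (p + n * dir ℓ d) ≠ 0 →
    (∀ k < n, t (p + k * dir ℓ d) = 0) →
    Run (sweepTime n) (cfg t p false d) (cfg t (p + n * dir ℓ d) false d)

theorem dir_mul_dir (d : Bool) : dir ℓ d * dir ℓ d = 1 := by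
  cases d <;> simp [dir]

theorem natCast_mul_dir_ne_zero {k : ℕ} (hk : 0 < k) (hkℓ : k < ℓ) (d : Bool) :
    (k : ZMod ℓ) * dir ℓ d ≠ 0 := by
  intro h
  have h' : (k : ZMod ℓ) = 0 := by
    have := congrArg (· * dir ℓ d) h
    simpa [mul_assoc, dir_mul_dir] using this
  rw [ZMod.natCast_eq_zero_iff] at h'
  exact absurd (Nat.le_of_dvd hk h') (by omega)

theorem add_natCast_mul_dir_ne {k : ℕ} (hk : 0 < k) (hkℓ : k < ℓ) (p : ZMod ℓ) (d : Bool) :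
    p + k * dir ℓ d ≠ p := by
  simpa using natCast_mul_dir_ne_zero hk hkℓ d

theorem sub_natCast_mul_dir_ne {k : ℕ} (hk : 0 < k) (hkℓ : k < ℓ) (p : ZMod ℓ) (d : Bool) :
    p - k * dir ℓ d ≠ p := by
  simpa using natCast_mul_dir_ne_zero hk hkℓ d

/-- A filled arrow moves past a zero by exploring the block of `n` zeros behind it. -/
theorem run_filled_pass {n : ℕ} (hA : FilledSweep ℓ n) (hB : HollowSweep ℓ n) (hn : n < ℓ)
    {t : ZMod ℓ → Letter} {p : ZMod ℓ} {d : Bool} (hp : t p = 0)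
    (hz : ∀ k < n, t (p - (k + 1 : ℕ) * dir ℓ d) = 0)
    (he : update t p 1 (p - (n + 1 : ℕ) * dir ℓ d) ≠ 0) :
    Run (3 ^ (n + 1)) (cfg t p true d) (cfg t (p + dir ℓ d) true d) := by
  have hz' : ∀ k < n, update t p 1 (p - (k + 1 : ℕ) * dir ℓ d) = 0 := fun k hk => by
    rw [update_of_ne (sub_natCast_mul_dir_ne (by omega) (by omega) p d), hz k hk]
  have r1 := run_filled_zero (d := d) hp
  have r2 := hA (update t p 1) (p - dir ℓ d) (!d) (by simp [dir_not]) fun k hk => by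
    rw [← hz' k hk, dir_not]
    congr 1
    push_cast
    ring
  have e2 : p - dir ℓ d + n * dir ℓ (!d) = p - (n + 1 : ℕ) * dir ℓ d := by
    rw [dir_not]; push_cast; ring
  rw [e2] at r2
  have r3 := run_filled_ne_zero (d := !d) he
  have e3 : p - (n + 1 : ℕ) * dir ℓ d - dir ℓ (!d) = p - n * dir ℓ d := by
    rw [dir_not]; push_cast; ring
  rw [e3, Bool.not_not] at r3
  have r4 := hB (update t p 1) (p - n * dir ℓ d) d (by simp) fun k hk => by
    rw [← hz' (n - 1 - k) (by omega)]
    congr 1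
    rw [show n - 1 - k + 1 = n - k by omega, Nat.cast_sub hk.le]
    ring
  rw [sub_add_cancel] at r4
  have r5 := run_hollow_one (d := d) (update_self p (1 : Letter) t)
  rw [update_idem, ← hp, update_eq_self] at r5
  have := (((r1.trans r2).trans r3).trans r4).trans r5
  rwa [sweepTime_eq] at this

/-- A hollow arrow moves past a zero by exploring the block of `n` zeros ahead of it. -/
theorem run_hollow_pass {n : ℕ} (hA : FilledSweep ℓ n) (hB : HollowSweep ℓ n) (hn : n < ℓ)
    {t : ZMod ℓ → Letter} {p : ZMod ℓ} {d : Bool} (hp : t p = 0)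
    (hz : ∀ k < n, t (p + (k + 1 : ℕ) * dir ℓ d) = 0)
    (he : update t p 2 (p + (n + 1 : ℕ) * dir ℓ d) ≠ 0) :
    Run (3 ^ (n + 1)) (cfg t p false d) (cfg t (p + dir ℓ d) false d) := by
  have hz' : ∀ k < n, update t p 2 (p + (k + 1 : ℕ) * dir ℓ d) = 0 := fun k hk => by
    rw [update_of_ne (add_natCast_mul_dir_ne (by omega) (by omega) p d), hz k hk]
  have r1 := run_hollow_zero (d := d) hp
  have r2 := hA (update t p 2) (p + dir ℓ d) d (by simp) fun k hk => by
    rw [← hz' k hk]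
    congr 1
    push_cast
    ring
  have e2 : p + dir ℓ d + n * dir ℓ d = p + (n + 1 : ℕ) * dir ℓ d := by
    push_cast; ring
  rw [e2] at r2
  have r3 := run_filled_ne_zero (d := d) he
  have e3 : p + (n + 1 : ℕ) * dir ℓ d - dir ℓ d = p + n * dir ℓ d := by
    push_cast; ring
  rw [e3] at r3
  have r4 := hB (update t p 2) (p + n * dir ℓ d) (!d) (by simp [dir_not]) fun k hk => by
    rw [← hz' (n - 1 - k) (by omega)]
    congr 1
    rw [show n - 1 - k + 1 = n - k by omega, Nat.cast_sub hk.le, dir_not]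
    ring
  rw [show p + n * dir ℓ d + n * dir ℓ (!d) = p by rw [dir_not]; ring] at r4
  have r5 := run_hollow_two (d := !d) (update_self p (2 : Letter) t)
  rw [update_idem, ← hp, update_eq_self, dir_not, sub_neg_eq_add, Bool.not_not] at r5
  have := (((r1.trans r2).trans r3).trans r4).trans r5
  rwa [sweepTime_eq] at this

theorem sweep {n : ℕ} (hn : n < ℓ) : FilledSweep ℓ n ∧ HollowSweep ℓ n := by
  induction n with
  | zero =>
    constructor <;> intro t p d _ _ <;> simpa [sweepTime] using Run.zero _
  | succ n ih =>
    obtain ⟨hA, hB⟩ := ih (by omega)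
    constructor
    · intro t p d hb hz
      have r1 := hA t p d hb fun k hk => hz k (by omega)
      have e : p + n * dir ℓ d - (n + 1 : ℕ) * dir ℓ d = p - dir ℓ d := by push_cast; ring
      have hne : p - dir ℓ d ≠ p + n * dir ℓ d := by
        rw [← e]
        exact sub_natCast_mul_dir_ne (by omega) hn _ d
      have r2 := run_filled_pass hA hB (by omega) (hz n (by omega))
        (fun k hk => by
          rw [← hz (n - 1 - k) (by omega)]
          congr 1
          rw [show n - 1 - k = n - (k + 1) by omega, Nat.cast_sub (by omega : k + 1 ≤ n)]
          ring)
        (by rwa [e, update_of_ne hne])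
      have := r1.trans r2
      rw [← sweepTime_eq] at this
      convert this using 2
      · rw [sweepTime]; ring
      · push_cast; ring
    · intro t p d hb hz
      have hne : p + (n + 1 : ℕ) * dir ℓ d ≠ p := add_natCast_mul_dir_ne (by omega) hn p d
      have r1 := run_hollow_pass hA hB (by omega) (by simpa using hz 0 (by omega))
        (fun k hk => hz (k + 1) (by omega)) (by rwa [update_of_ne hne])
      have e : ∀ k : ℕ, p + dir ℓ d + k * dir ℓ d = p + (k + 1 : ℕ) * dir ℓ d := fun k => by
        push_cast; ring
      have r2 := hB t (p + dir ℓ d) d (by rwa [e]) fun k hk => by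
        rw [e]; exact hz (k + 1) (by omega)
      rw [e] at r2
      have := r1.trans r2
      rwa [← sweepTime_eq] at this

/-! ### The orbits of the initial configurations -/

theorem natCast_self_mul_dir (d : Bool) : (ℓ : ZMod ℓ) * dir ℓ d = 0 := by simp

/-- On the zero tape every arrow moves by one cell in `3 ^ ℓ` pairs of transitions. -/
theorem run_zero_tape (hℓ : 0 < ℓ) (p : ZMod ℓ) (s d : Bool) :
    Run (3 ^ ℓ) (cfg 0 p s d) (cfg 0 (p + dir ℓ d) s d) := by
  obtain ⟨n, rfl⟩ := Nat.exists_eq_add_one.mpr hℓ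
  obtain ⟨hA, hB⟩ := sweep (Nat.lt_succ_self n)
  cases s
  · exact run_hollow_pass hA hB (by omega) rfl (fun _ _ => rfl)
      (by rw [natCast_self_mul_dir, add_zero, update_self]; decide)
  · exact run_filled_pass hA hB (by omega) rfl (fun _ _ => rfl)
      (by rw [natCast_self_mul_dir, sub_zero, update_self]; decide)

theorem run_zero_tape_mul (hℓ : 0 < ℓ) (p : ZMod ℓ) (s d : Bool) (k : ℕ) :
    Run (k * 3 ^ ℓ) (cfg 0 p s d) (cfg 0 (p + k * dir ℓ d) s d) := by
  induction k with
  | zero => simpa using Run.zero _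
  | succ k ih =>
    have := ih.trans (run_zero_tape hℓ _ s d)
    convert this using 2
    · ring
    · push_cast; ring

theorem exists_add_mul_dir_eq (hℓ : 0 < ℓ) (p i : ZMod ℓ) (d : Bool) :
    ∃ k < ℓ, p + (k : ℕ) * dir ℓ d = i := by
  have : NeZero ℓ := ⟨hℓ.ne'⟩
  refine ⟨((i - p) * dir ℓ d).val, ZMod.val_lt _, ?_⟩
  rw [ZMod.natCast_zmod_val, mul_assoc, dir_mul_dir]
  ring

/-- From any position and in any direction there is a first nonzero letter, if there is one. -/
theorem exists_first_ne_zero (hℓ : 0 < ℓ) {t : ZMod ℓ → Letter} (ht : t ≠ 0) (p : ZMod ℓ)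
    (d : Bool) : ∃ n < ℓ, t (p + (n : ℕ) * dir ℓ d) ≠ 0 ∧
      ∀ k < n, t (p + (k : ℕ) * dir ℓ d) = 0 := by
  classical
  obtain ⟨i, hi⟩ := Function.ne_iff.mp ht
  obtain ⟨m, hm, rfl⟩ := exists_add_mul_dir_eq hℓ p i d
  have hex : ∃ n : ℕ, t (p + n * dir ℓ d) ≠ 0 := ⟨m, hi⟩
  exact ⟨Nat.find hex, (Nat.find_min' hex hi).trans_lt hm, Nat.find_spec hex,
    fun k hk => not_not.mp (Nat.find_min hex hk)⟩

theorem exists_run_filled_pass (hℓ : 0 < ℓ) {t : ZMod ℓ → Letter} {p : ZMod ℓ} (d : Bool)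
    (hp : t p = 0) : ∃ m, Run m (cfg t p true d) (cfg t (p + dir ℓ d) true d) := by
  have hne : update t p 1 ≠ 0 := fun h => by simpa using congrFun h p
  obtain ⟨n, hn, he, hz⟩ := exists_first_ne_zero hℓ hne (p - dir ℓ d) (!d)
  have e : ∀ k : ℕ, p - dir ℓ d + k * dir ℓ (!d) = p - (k + 1 : ℕ) * dir ℓ d := fun k => by
    rw [dir_not]; push_cast; ring
  obtain ⟨hA, hB⟩ := sweep hn
  refine ⟨_, run_filled_pass hA hB hn hp (fun k hk => ?_) (e n ▸ he)⟩
  have := hz k hk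
  rwa [e, update_of_ne (sub_natCast_mul_dir_ne (by omega) (by omega) p d)] at this

theorem exists_run_filled (hℓ : 0 < ℓ) {t : ZMod ℓ → Letter} {p : ZMod ℓ} {d : Bool} {n : ℕ}
    (hz : ∀ k < n, t (p + (k : ℕ) * dir ℓ d) = 0) :
    ∃ m, Run m (cfg t p true d) (cfg t (p + n * dir ℓ d) true d) := by
  induction n with
  | zero => exact ⟨0, by simpa using Run.zero _⟩
  | succ n ih =>
    obtain ⟨m, hm⟩ := ih fun k hk => hz k (by omega)
    obtain ⟨m', hm'⟩ := exists_run_filled_pass hℓ d (hz n (by omega))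
    refine ⟨m + m', ?_⟩
    convert hm.trans hm' using 2
    push_cast
    ring

/-- A hollow arrow on a nonzero tape eventually erases a letter. -/
theorem exists_run_hollow_erase (hℓ : 0 < ℓ) {t : ZMod ℓ → Letter} (ht : t ≠ 0) (p : ZMod ℓ)
    (d : Bool) : ∃ m i p' s' d', t i ≠ 0 ∧
      Run m (cfg t p false d) (cfg (update t i 0) p' s' d') := by
  obtain ⟨n, hn, he, hz⟩ := exists_first_ne_zero hℓ ht p d
  have r := (sweep hn).2 t p d he hz
  have h : ∀ a : Letter, a ≠ 0 → a = 1 ∨ a = 2 := by decide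
  rcases h _ he with h | h
  · exact ⟨_, _, _, _, _, he, r.trans (run_hollow_one h)⟩
  · exact ⟨_, _, _, _, _, he, r.trans (run_hollow_two h)⟩

theorem exists_run_erase (hℓ : 0 < ℓ) {t : ZMod ℓ → Letter} (ht : t ≠ 0) (p : ZMod ℓ)
    (s d : Bool) : ∃ m i p' s' d', t i ≠ 0 ∧
      Run m (cfg t p s d) (cfg (update t i 0) p' s' d') := by
  cases s
  · exact exists_run_hollow_erase hℓ ht p d
  · obtain ⟨n, -, he, hz⟩ := exists_first_ne_zero hℓ ht p d
    obtain ⟨m, hm⟩ := exists_run_filled hℓ hz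
    obtain ⟨m', i, p', s', d', hi, hm'⟩ :=
      exists_run_hollow_erase hℓ ht (p + n * dir ℓ d - dir ℓ d) (!d)
    exact ⟨_, i, p', s', d', hi, (hm.trans (run_filled_ne_zero he)).trans hm'⟩

theorem exists_run_zero_tape [NeZero ℓ] (t : ZMod ℓ → Letter) (p : ZMod ℓ) (s d : Bool) :
    ∃ m p' s' d', Run m (cfg t p s d) (cfg 0 p' s' d') := by
  induction hN : (Finset.univ.filter fun i => t i ≠ 0).card using Nat.strong_induction_on
    generalizing t p s d with
  | _ N ih =>
    by_cases ht : t = 0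
    · exact ⟨0, p, s, d, ht ▸ Run.zero _⟩
    · obtain ⟨m, i, p', s', d', hi, hm⟩ := exists_run_erase (NeZero.pos ℓ) ht p s d
      have hlt : (Finset.univ.filter fun j => update t i 0 j ≠ 0).card < N := by
        rw [← hN]
        refine Finset.card_lt_card (Finset.ssubset_iff_of_subset (fun j => ?_) |>.mpr
          ⟨i, by simpa using hi, by simp⟩)
        by_cases hj : j = i <;> simp [hj]
      obtain ⟨m', p₁, s₁, d₁, hm'⟩ := ih _ hlt (update t i 0) p' s' d' rfl
      exact ⟨_, p₁, s₁, d₁, hm.trans hm'⟩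

theorem exists_run_init [NeZero ℓ] (t : ZMod ℓ → Letter) (p : ZMod ℓ) (s d : Bool) :
    ∃ m s' d', Run m (cfg t p s d) (cfg 0 0 s' d') := by
  obtain ⟨m, p', s', d', hm⟩ := exists_run_zero_tape t p s d
  obtain ⟨k, -, hk⟩ := exists_add_mul_dir_eq (NeZero.pos ℓ) p' 0 d'
  have r := run_zero_tape_mul (NeZero.pos ℓ) p' s' d' k
  rw [hk] at r
  exact ⟨_, s', d', hm.trans r⟩

/-- The initial configuration in state `q` of index `1`. -/
def start (ℓ : ℕ) (q : Arrow) : Cfg ℓ := (0, 0, q, 0)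

theorem toWord_start (q : Arrow) : toWord (start ℓ q) = initConf ℓ q := rfl

theorem exists_iterate_tick_eq_start [NeZero ℓ] (c : Cfg ℓ) : ∃ m q, tick^[m] c = start ℓ q := by
  have matching : ∀ (t : ZMod ℓ → Letter) (p : ZMod ℓ) (s d : Bool),
      ∃ m q, tick^[m] (t, p, arrow s d, 0) = start ℓ q := fun t p s d => by
    obtain ⟨m, s', d', h⟩ := exists_run_init t p s d
    exact ⟨2 * m, arrow s' d', h⟩
  obtain ⟨t, p, q, b⟩ := c
  obtain ⟨s, d, rfl⟩ := exists_arrow q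
  fin_cases b
  · exact matching t p s d
  · obtain ⟨m, q, h⟩ := matching t (p + dir ℓ d) s d
    refine ⟨m + 1, q, ?_⟩
    rw [iterate_succ_apply, ← h]
    exact congrArg _ (tick_move t p s d)

theorem isPeriodicPt_start (hℓ : 0 < ℓ) (q : Arrow) :
    IsPeriodicPt tick (2 * ℓ * 3 ^ ℓ) (start ℓ q) := by
  obtain ⟨s, d, rfl⟩ := exists_arrow q
  have := run_zero_tape_mul hℓ 0 s d ℓ
  rw [natCast_self_mul_dir, add_zero, Run, ← mul_assoc] at this
  exact this

/-- Every configuration with a head is visited from exactly one initial configuration at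
exactly one time. -/
theorem orbit_bijective [NeZero ℓ] :
    Bijective fun x : Arrow × Fin (2 * ℓ * 3 ^ ℓ) => tick^[x.2] (start ℓ x.1) := by
  rw [Fintype.bijective_iff_surjective_and_card]
  constructor
  · intro c
    obtain ⟨m, q, hm⟩ := exists_iterate_tick_eq_start c
    obtain ⟨P, hP, hc⟩ := tick_injective.mem_periodicPts c
    have hpos : 0 < 2 * ℓ * 3 ^ ℓ := by have := NeZero.pos ℓ; positivity
    refine ⟨(q, ⟨(m * P - m) % (2 * ℓ * 3 ^ ℓ), Nat.mod_lt _ hpos⟩), ?_⟩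
    simp only
    rw [(isPeriodicPt_start (NeZero.pos ℓ) q).iterate_mod_apply, ← hm, ← iterate_add_apply,
      Nat.sub_add_cancel (Nat.le_mul_of_pos_right m hP)]
    exact hc.const_mul m
  · have hA : Fintype.card Arrow = 4 := rfl
    simp only [Fintype.card_prod, Fintype.card_fun, Fintype.card_fin, ZMod.card, hA]
    ring

theorem stepC_comp_add (v : ZMod ℓ) (w : ZMod ℓ → TSym SQ Letter) :
    (stepC smartStep ℓ fun i => w (i + v)) = fun i => stepC smartStep ℓ w (i + v) := by
  funext i
  simp only [stepC, add_right_comm, sub_add_eq_add_sub]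

/-- After `2 * 3 ^ ℓ` transitions the orbit of an initial configuration is shifted by one cell. -/
theorem iterate_shift (hℓ : 2 ≤ ℓ) (s d : Bool) (n : ℕ) :
    (stepC smartStep ℓ)^[2 * 3 ^ ℓ] ((stepC smartStep ℓ)^[n] (initConf ℓ (arrow s d))) =
      fun i => (stepC smartStep ℓ)^[n] (initConf ℓ (arrow s d)) (i + -dir ℓ d) := by
  have h : (stepC smartStep ℓ)^[2 * 3 ^ ℓ] (initConf ℓ (arrow s d)) =
      fun i => initConf ℓ (arrow s d) (i + -dir ℓ d) := by
    have := run_zero_tape (by omega : 0 < ℓ) 0 s d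
    rw [← toWord_start, ← toWord_iterate_tick hℓ]
    refine (congrArg toWord this).trans ?_
    funext i
    simp [toWord, cfg, start, ← sub_eq_add_neg, sub_eq_zero]
  rw [← iterate_add_apply, add_comm, iterate_add_apply, h]
  exact Semiconj.iterate_right (f := fun (w : ZMod ℓ → TSym SQ Letter) i => w (i + -dir ℓ d))
    (fun w => (stepC_comp_add _ w).symm) n _ |>.symm

end

end Smart

/-- **Lemma.** For `ℓ ≥ 2`, the action of SMART on head-containing cyclic tapes of length
`ℓ` consists of exactly four disjoint cycles of length `2ℓ·3^ℓ`, the orbits of the four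
initial configurations: every head-containing `w` is `T_ℓ^n(C_q)` for exactly one pair
`(q, n)` with `n < 2ℓ·3^ℓ`.  Moreover the `(2·3^ℓ)`-th power of SMART acts as the right
shift on the orbits of `C_▶, C_▷` and as the left shift on the orbits of `C_◀, C_◁`. -/
theorem smart_cyclic_orbits (ℓ : ℕ) (hℓ : 2 ≤ ℓ) :
    (∀ w : ZMod ℓ → TSym SQ Letter, AtMostOneHeadC w → (∃ i, (w i).isRight = true) →
      ∃ (q : Arrow) (n : ℕ), n < 2 * ℓ * 3 ^ ℓ ∧
        w = (stepC smartStep ℓ)^[n] (initConf ℓ q) ∧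
        ∀ (q' : Arrow) (n' : ℕ), n' < 2 * ℓ * 3 ^ ℓ →
          w = (stepC smartStep ℓ)^[n'] (initConf ℓ q') → q' = q ∧ n' = n) ∧
    (∀ n : ℕ,
      ((stepC smartStep ℓ)^[2 * 3 ^ ℓ] ((stepC smartStep ℓ)^[n] (initConf ℓ .rf)) =
        fun i => (stepC smartStep ℓ)^[n] (initConf ℓ .rf) (i - 1)) ∧
      ((stepC smartStep ℓ)^[2 * 3 ^ ℓ] ((stepC smartStep ℓ)^[n] (initConf ℓ .rh)) =
        fun i => (stepC smartStep ℓ)^[n] (initConf ℓ .rh) (i - 1)) ∧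
      ((stepC smartStep ℓ)^[2 * 3 ^ ℓ] ((stepC smartStep ℓ)^[n] (initConf ℓ .lf)) =
        fun i => (stepC smartStep ℓ)^[n] (initConf ℓ .lf) (i + 1)) ∧
      ((stepC smartStep ℓ)^[2 * 3 ^ ℓ] ((stepC smartStep ℓ)^[n] (initConf ℓ .lh)) =
        fun i => (stepC smartStep ℓ)^[n] (initConf ℓ .lh) (i + 1))) := by
  have : NeZero ℓ := ⟨by omega⟩
  refine ⟨fun w hw hh => ?_, fun n => ?_⟩
  · obtain ⟨c, rfl⟩ := Smart.exists_toWord_eq hw hh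
    obtain ⟨⟨q, n⟩, rfl⟩ := Smart.orbit_bijective.surjective c
    refine ⟨q, n, n.isLt, ?_, fun q' n' hn' h => ?_⟩
    · rw [← Smart.toWord_start, ← Smart.toWord_iterate_tick hℓ]
    · rw [← Smart.toWord_start, ← Smart.toWord_iterate_tick hℓ] at h
      have := Smart.orbit_bijective.injective
        (a₁ := (q, n)) (a₂ := (q', ⟨n', hn'⟩)) (Smart.toWord_injective h)
      rw [Prod.mk.injEq] at this
      exact ⟨this.1.symm, congrArg Fin.val this.2.symm⟩
  · have h := fun s d => Smart.iterate_shift hℓ s d n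
    refine ⟨(h true true).trans ?_, (h false true).trans ?_, (h true false).trans ?_,
      (h false false).trans ?_⟩ <;> simp [Smart.dir, Smart.arrow, sub_eq_add_neg]
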